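/- For all n ≥ 0, j(8n+7) ≡ 0 (mod 64). -/

import Mathlib

/-- A 01-partition: a finite sequence of non-negative integers whose last entry is ≥ 1,
satisfying the weakly decreasing conditions `n_j ≥ n_{j+1} - 1` and `n_j ≥ n_{j+2}`. -/
def Is01 (l : List ℕ) : Prop :=
  (∀ i, i + 1 < l.length → l[i + 1]! ≤ l[i]! + 1) ∧
  (∀ i, i + 2 < l.length → l[i + 2]! ≤ l[i]!) ∧
  (l ≠ [] → 1 ≤ l.getLast!)

/-- `j01 n` is the number of 01-partitions of `n` (with `j01 0 = 1`, the empty sequence). -/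
noncomputable def j01 (n : ℕ) : ℕ := Nat.card {l : List ℕ // Is01 l ∧ l.sum = n}

open PowerSeries Finset

theorem is01_nil : Is01 [] := by simp [Is01]

theorem is01_cons (a : ℕ) (l : List ℕ) :
    Is01 (a :: l) ↔ Is01 l ∧ l[0]! ≤ a + 1 ∧ l[1]! ≤ a ∧ (l = [] → 1 ≤ a) := by
  rcases l with _ | ⟨b, t⟩
  · simp [Is01]
  · constructor
    · rintro ⟨h1, h2, h3⟩
      refine ⟨⟨fun i hi => ?_, fun i hi => ?_, fun _ => ?_⟩, ?_, ?_, by simp⟩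
      · simpa using h1 (i + 1) (by simpa using hi)
      · simpa using h2 (i + 1) (by simpa using hi)
      · simpa using h3 (by simp)
      · simpa using h1 0 (by simp)
      · rcases t with _ | ⟨c, t⟩
        · simp
        · simpa using h2 0 (by simp)
    · rintro ⟨⟨h1, h2, h3⟩, h4, h5, -⟩
      refine ⟨fun i hi => ?_, fun i hi => ?_, fun _ => ?_⟩
      · rcases i with _ | i
        · simpa using h4
        · simpa using h1 i (by simpa using hi)
      · rcases i with _ | i
        · simpa using h5
        · simpa using h2 i (by simpa using hi)
      · simpa using h3 (by simp)

/-- The 01-partitions whose first entry is at most `a` and whose second entry is at most `b`. -/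
def boundedIs01 (a b : ℕ) : Set (List ℕ) := {l | Is01 l ∧ l[0]! ≤ a ∧ l[1]! ≤ b}

theorem boundedIs01_zero_zero : boundedIs01 0 0 = {[]} := by
  have key : ∀ l : List ℕ, Is01 l → l[0]! ≤ 0 → l[1]! ≤ 0 → l = [] := by
    intro l
    induction l with
    | nil => simp
    | cons a t ih =>
      intro h h0 h1
      rw [is01_cons] at h
      simp only [List.getElem!_cons_zero, List.getElem!_cons_succ] at h0 h1
      have := h.2.2.2 (ih h.1 h1 (h.2.2.1.trans h0))
      omega
  ext l
  exact ⟨fun h => key l h.1 h.2.1 h.2.2, by rintro rfl; simp [boundedIs01, is01_nil]⟩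

theorem boundedIs01_succ_succ (k : ℕ) :
    boundedIs01 (k + 1) (k + 1) =
      boundedIs01 k (k + 1) ∪ (fun l => (k + 1) :: l) '' boundedIs01 (k + 1) (k + 1) := by
  ext l
  rcases l with _ | ⟨a, t⟩
  · simp [boundedIs01, is01_nil]
  · simp only [boundedIs01, Set.mem_union, Set.mem_image, Set.mem_ofPred_eq, is01_cons,
      List.getElem!_cons_zero, List.getElem!_cons_succ, List.cons.injEq]
    constructor
    · rintro ⟨⟨h1, h2, h3, h4⟩, h5, h6⟩
      rcases h5.lt_or_eq with h | rfl
      · exact Or.inl ⟨⟨h1, h2, h3, h4⟩, by omega, h6⟩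
      · exact Or.inr ⟨t, ⟨h1, h6, h3⟩, rfl, rfl⟩
    · rintro (⟨⟨h1, h2, h3, h4⟩, h5, h6⟩ | ⟨_, ⟨h1, h2, h3⟩, rfl, rfl⟩)
      · exact ⟨⟨h1, h2, h3, h4⟩, by omega, h6⟩
      · exact ⟨⟨h1, by omega, h3, by omega⟩, le_rfl, h2⟩

theorem boundedIs01_self_succ (k : ℕ) :
    boundedIs01 k (k + 1) =
      boundedIs01 k k ∪ (fun l => k :: (k + 1) :: l) '' boundedIs01 k (k + 1) := by
  ext l
  rcases l with _ | ⟨a, _ | ⟨b, t⟩⟩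
  · simp [boundedIs01, is01_nil]
  · simp [boundedIs01]
  · simp only [boundedIs01, Set.mem_union, Set.mem_image, Set.mem_ofPred_eq, is01_cons,
      List.getElem!_cons_zero, List.getElem!_cons_succ, List.cons.injEq, reduceCtorEq,
      false_imp_iff, and_true]
    constructor
    · rintro ⟨⟨⟨h1, h2, h3, h4⟩, h5, h6⟩, h7, h8⟩
      rcases h8.lt_or_eq with h | rfl
      · exact Or.inl ⟨⟨⟨h1, h2, h3, h4⟩, h5, h6⟩, h7, by omega⟩
      · obtain rfl : a = k := by omega
        exact Or.inr ⟨t, ⟨h1, h6, h3⟩, rfl, rfl, rfl⟩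
    · rintro (⟨⟨⟨h1, h2, h3, h4⟩, h5, h6⟩, h7, h8⟩ | ⟨_, ⟨h1, h2, h3⟩, rfl, rfl, rfl⟩)
      · exact ⟨⟨⟨h1, h2, h3, h4⟩, h5, h6⟩, h7, by omega⟩
      · exact ⟨⟨⟨h1, by omega, h3, by omega⟩, le_rfl, h2⟩, le_rfl, le_rfl⟩

/-- The generating function, by sum, of a set of lists. -/
noncomputable def sumGenFun (A : Set (List ℕ)) : ℤ⟦X⟧ :=
  PowerSeries.mk fun n => ({l ∈ A | l.sum = n}.ncard : ℤ)

theorem finite_fiber_of_eq_union_image {A B : Set (List ℕ)} {f : List ℕ → List ℕ} {d : ℕ}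
    (hd : 0 < d) (hsum : ∀ l, (f l).sum = l.sum + d) (hA : A = B ∪ f '' A)
    (hB : ∀ n, {l ∈ B | l.sum = n}.Finite) (n : ℕ) : {l ∈ A | l.sum = n}.Finite := by
  induction n using Nat.strong_induction_on with
  | _ n ih =>
    refine ((hB n).union ((Set.Finite.image f (s := ⋃ m ∈ Finset.range n, {l ∈ A | l.sum = m})
      (Set.Finite.biUnion (Finset.finite_toSet _) fun m hm => ih m (by simpa using hm))))).subset ?_
    rintro l ⟨hl, rfl⟩
    rw [hA] at hl
    rcases hl with hl | ⟨t, ht, rfl⟩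
    · exact Or.inl ⟨hl, rfl⟩
    · refine Or.inr ⟨t, ?_, rfl⟩
      simp only [Set.mem_iUnion]
      exact ⟨t.sum, by simp [hsum, hd], ht, rfl⟩

theorem sumGenFun_mul_one_sub {A B : Set (List ℕ)} {f : List ℕ → List ℕ} {d : ℕ}
    (hd : 0 < d) (hsum : ∀ l, (f l).sum = l.sum + d) (hf : f.Injective) (hA : A = B ∪ f '' A)
    (hdisj : Disjoint B (f '' A)) (hB : ∀ n, {l ∈ B | l.sum = n}.Finite) :
    sumGenFun A * (1 - X ^ d) = sumGenFun B := by
  have hfin := finite_fiber_of_eq_union_image hd hsum hA hB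
  ext n
  rw [mul_sub, mul_one, map_sub, coeff_mul_X_pow', sub_eq_iff_eq_add]
  simp only [sumGenFun, coeff_mk]
  have hsplit : {l ∈ A | l.sum = n} = {l ∈ B | l.sum = n} ∪ {l ∈ f '' A | l.sum = n} := by
    ext l
    conv_lhs => rw [hA]
    simp only [Set.mem_ofPred_eq, Set.mem_union]
    tauto
  have hdis : Disjoint {l ∈ B | l.sum = n} {l ∈ f '' A | l.sum = n} :=
    hdisj.mono (fun _ h => h.1) (fun _ h => h.1)
  have hfin' : {l ∈ f '' A | l.sum = n}.Finite :=
    (hfin n).subset (hsplit ▸ Set.subset_union_right)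
  rw [hsplit, Set.ncard_union_eq hdis (hB n) hfin', Nat.cast_add]
  congr 1
  split_ifs with h
  · have himage : {l ∈ f '' A | l.sum = n} = f '' {l ∈ A | l.sum = n - d} := by
      ext l
      constructor
      · rintro ⟨⟨t, ht, rfl⟩, hs⟩
        exact ⟨t, ⟨ht, by have := hsum t; omega⟩, rfl⟩
      · rintro ⟨t, ⟨ht, hs⟩, rfl⟩
        exact ⟨⟨t, ht, rfl⟩, by have := hsum t; omega⟩
    rw [himage, Set.ncard_image_of_injective _ hf]
  · rw [Nat.cast_eq_zero, Set.ncard_eq_zero hfin', Set.eq_empty_iff_forall_notMem]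
    rintro _ ⟨⟨t, -, rfl⟩, hs⟩
    have := hsum t
    omega

theorem disjoint_cons_image (k : ℕ) (A : Set (List ℕ)) :
    Disjoint (boundedIs01 k (k + 1)) ((fun l => (k + 1) :: l) '' A) := by
  rw [Set.disjoint_left]
  rintro _ ⟨-, h, -⟩ ⟨t, -, rfl⟩
  simp at h

theorem disjoint_cons_cons_image (k : ℕ) (A : Set (List ℕ)) :
    Disjoint (boundedIs01 k k) ((fun l => k :: (k + 1) :: l) '' A) := by
  rw [Set.disjoint_left]
  rintro _ ⟨-, -, h⟩ ⟨t, -, rfl⟩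
  simp at h

theorem sum_cons_cons (k : ℕ) (l : List ℕ) :
    (k :: (k + 1) :: l).sum = l.sum + (2 * k + 1) := by
  simp only [List.sum_cons]; ring

theorem finite_boundedIs01_sum (k : ℕ) : ∀ n, {l ∈ boundedIs01 k k | l.sum = n}.Finite := by
  induction k with
  | zero =>
    intro n
    rw [boundedIs01_zero_zero]
    exact (Set.finite_singleton []).subset fun _ h => h.1
  | succ k ih =>
    exact finite_fiber_of_eq_union_image k.succ_pos (fun l => by simp [add_comm])
      (boundedIs01_succ_succ k) (finite_fiber_of_eq_union_image (2 * k).succ_pos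
        (sum_cons_cons k) (boundedIs01_self_succ k) ih)

theorem sumGenFun_boundedIs01_mul_prod (k : ℕ) :
    sumGenFun (boundedIs01 k k) *
      ((∏ i ∈ range k, (1 - X ^ (i + 1))) * ∏ i ∈ range k, (1 - X ^ (2 * i + 1))) = 1 := by
  induction k with
  | zero =>
    ext n
    rw [boundedIs01_zero_zero]
    simp only [sumGenFun, range_zero, prod_empty, mul_one, coeff_mk, coeff_one]
    split_ifs with h
    · subst h
      rw [Nat.cast_eq_one, Set.ncard_eq_one]
      exact ⟨[], by ext l; simp +contextual⟩
    · rw [Nat.cast_eq_zero]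
      convert Set.ncard_empty (List ℕ)
      ext l
      simp only [Set.mem_ofPred_eq, Set.mem_singleton_iff, Set.mem_empty_iff_false, iff_false]
      rintro ⟨rfl, h'⟩
      exact h h'.symm
  | succ k ih =>
    have hfin := finite_fiber_of_eq_union_image (2 * k).succ_pos
        (sum_cons_cons k) (boundedIs01_self_succ k) (finite_boundedIs01_sum k)
    have h1 := sumGenFun_mul_one_sub k.succ_pos (fun l => by simp [add_comm])
      (fun _ _ h => by simpa using h) (boundedIs01_succ_succ k) (disjoint_cons_image k _) hfin
    have h2 := sumGenFun_mul_one_sub (2 * k).succ_pos (sum_cons_cons k)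
      (fun _ _ h => by simpa using h) (boundedIs01_self_succ k) (disjoint_cons_cons_image k _)
      (finite_boundedIs01_sum k)
    simp only [Nat.succ_eq_add_one] at h1 h2
    rw [prod_range_succ, prod_range_succ]
    refine Eq.trans ?_ ih
    rw [← h2, ← h1]
    ring

theorem coeff_sumGenFun_boundedIs01 {n k : ℕ} (h : n ≤ k) :
    coeff n (sumGenFun (boundedIs01 k k)) = j01 n := by
  have hle (l : List ℕ) (i : ℕ) : l[i]! ≤ l.sum := by
    rcases lt_or_ge i l.length with hi | hi
    · rw [getElem!_pos l i hi]
      exact List.le_sum_of_mem (List.getElem_mem hi)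
    · simp [hi]
  rw [sumGenFun, coeff_mk, j01, ← Set.coe_ofPred, Nat.card_coe_set_eq]
  congr 2
  ext l
  constructor
  · exact fun hl => ⟨hl.1.1, hl.2⟩
  · rintro ⟨hl, rfl⟩
    exact ⟨⟨hl, (hle l 0).trans h, (hle l 1).trans h⟩, rfl⟩

section QBinomial

variable {R : Type*} [CommRing R]

/-- The Gaussian binomial coefficient with base `q`. -/
def qBinom (q : R) : ℕ → ℕ → R
  | _, 0 => 1
  | 0, _ + 1 => 0
  | n + 1, k + 1 => qBinom q n k + q ^ (k + 1) * qBinom q n (k + 1)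

theorem qBinom_zero_right (q : R) (n : ℕ) : qBinom q n 0 = 1 := by
  cases n <;> rfl

theorem qBinom_succ_succ (q : R) (n k : ℕ) :
    qBinom q (n + 1) (k + 1) = qBinom q n k + q ^ (k + 1) * qBinom q n (k + 1) := rfl

theorem qBinom_eq_zero_of_lt (q : R) : ∀ {n k : ℕ}, n < k → qBinom q n k = 0
  | _, 0, h => by omega
  | 0, _ + 1, _ => rfl
  | n + 1, k + 1, h => by
    rw [qBinom_succ_succ, qBinom_eq_zero_of_lt q (by omega : n < k),
      qBinom_eq_zero_of_lt q (by omega : n < k + 1), mul_zero, add_zero]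

theorem qBinom_self (q : R) (n : ℕ) : qBinom q n n = 1 := by
  induction n with
  | zero => rfl
  | succ n ih => rw [qBinom_succ_succ, ih, qBinom_eq_zero_of_lt q n.lt_succ_self]; ring

/-- The finite product `(1 - q)(1 - q²)⋯(1 - qⁿ)`. -/
def qPoch (q : R) (n : ℕ) : R := ∏ i ∈ range n, (1 - q ^ (i + 1))

theorem qPoch_succ (q : R) (n : ℕ) : qPoch q (n + 1) = qPoch q n * (1 - q ^ (n + 1)) :=
  prod_range_succ _ _

theorem qBinom_add_mul_qPoch (q : R) : ∀ a b : ℕ,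
    qBinom q (a + b) a * (qPoch q a * qPoch q b) = qPoch q (a + b)
  | 0, b => by simp [qBinom_zero_right, qPoch]
  | a + 1, 0 => by simp [qBinom_self, qPoch]
  | a + 1, b + 1 => by
    have h1 := qBinom_add_mul_qPoch q a (b + 1)
    have h2 := qBinom_add_mul_qPoch q (a + 1) b
    rw [show a + 1 + (b + 1) = a + b + 1 + 1 by ring, qBinom_succ_succ, qPoch_succ q (a + b + 1)]
    rw [show a + (b + 1) = a + b + 1 by ring] at h1
    rw [show a + 1 + b = a + b + 1 by ring] at h2
    rw [qPoch_succ] at h1 h2 ⊢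
    rw [qPoch_succ q b]
    linear_combination (1 - q ^ (a + 1)) * h1 + q ^ (a + 1) * (1 - q ^ (b + 1)) * h2

/-- The `q`-binomial theorem. -/
theorem prod_add_mul_pow_eq_sum_qBinom (q a b : R) (n : ℕ) :
    ∏ i ∈ range n, (a + b * q ^ i) =
      ∑ k ∈ range (n + 1), q ^ (k.choose 2) * qBinom q n k * a ^ (n - k) * b ^ k := by
  induction n generalizing b with
  | zero => simp [qBinom_zero_right]
  | succ n ih =>
    have hprod : ∏ i ∈ range n, (a + b * q ^ (i + 1)) = ∏ i ∈ range n, (a + b * q * q ^ i) :=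
      prod_congr rfl fun i _ => by ring
    rw [prod_range_succ', hprod, ih, pow_zero, mul_one, mul_add, sum_mul, sum_mul,
      sum_range_succ' _ (n + 1)]
    have htop : ∑ k ∈ range (n + 1), q ^ (k.choose 2) * qBinom q n k * a ^ (n - k) *
        (b * q) ^ k * a = (∑ k ∈ range (n + 1), q ^ ((k + 1).choose 2) * qBinom q n (k + 1) *
          a ^ (n - k) * (b * q) ^ (k + 1)) + a ^ (n + 1) := by
      rw [sum_range_succ', sum_range_succ _ n, qBinom_eq_zero_of_lt q n.lt_succ_self]
      simp only [mul_zero, zero_mul, add_zero, Nat.choose_zero_succ, qBinom_zero_right, pow_zero,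
        Nat.sub_zero, one_mul, mul_one]
      congr 1
      · refine sum_congr rfl fun k hk => ?_
        rw [show n - k = n - (k + 1) + 1 by have := mem_range.1 hk; omega]
        ring
      · ring
    rw [htop, add_right_comm, ← sum_add_distrib]
    congr 1
    · refine sum_congr rfl fun k _ => ?_
      rw [Nat.add_sub_add_right, qBinom_succ_succ, Nat.choose_succ_succ' k 1, Nat.choose_one_right]
      ring
    · simp [qBinom_zero_right]

theorem qPoch_eq_of_pow_eq_zero {q : R} {m n : ℕ} (hq : q ^ (m + 1) = 0) (h : m ≤ n) :
    qPoch q n = qPoch q m := by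
  obtain ⟨d, rfl⟩ := Nat.exists_eq_add_of_le h
  have htail : ∏ i ∈ range d, (1 - q ^ (m + i + 1)) = 1 :=
    prod_eq_one fun i _ => by rw [pow_eq_zero_of_le (by omega) hq, sub_zero]
  rw [qPoch, prod_range_add, htail, mul_one, qPoch]

theorem isUnit_qPoch {q : R} (hq : IsNilpotent q) (n : ℕ) : IsUnit (qPoch q n) := by
  induction n with
  | zero => simp [qPoch]
  | succ n ih => exact qPoch_succ q n ▸ ih.mul (hq.pow_succ n).isUnit_one_sub

theorem qBinom_mul_qPoch_eq_one {q : R} {m k l : ℕ} (hq : q ^ (m + 1) = 0) (hk : m ≤ k)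
    (hl : m ≤ l) : qBinom q (k + l) k * qPoch q (k + l) = 1 := by
  have h := qBinom_add_mul_qPoch q k l
  rw [qPoch_eq_of_pow_eq_zero hq hk, qPoch_eq_of_pow_eq_zero hq hl,
    qPoch_eq_of_pow_eq_zero hq (by omega : m ≤ k + l), ← mul_assoc] at h
  rw [qPoch_eq_of_pow_eq_zero hq (by omega : m ≤ k + l)]
  exact (isUnit_qPoch ⟨_, hq⟩ m).mul_right_cancel (h.trans (one_mul _).symm)

theorem qPoch_two_mul (q : R) (n : ℕ) :
    qPoch q (2 * n) = (∏ i ∈ range n, (1 - q ^ (2 * i + 1))) * qPoch (q ^ 2) n := by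
  induction n with
  | zero => simp [qPoch]
  | succ n ih =>
    rw [show 2 * (n + 1) = 2 * n + 1 + 1 by ring, qPoch_succ, qPoch_succ, ih, qPoch_succ,
      prod_range_succ]
    ring

theorem map_qPoch {S : Type*} [CommRing S] (φ : R →+* S) (q : R) (n : ℕ) :
    φ (qPoch q n) = qPoch (φ q) n := by
  simp [qPoch, map_prod]

theorem map_qBinom {S : Type*} [CommRing S] (φ : R →+* S) (q : R) : ∀ n k : ℕ,
    φ (qBinom q n k) = qBinom (φ q) n k
  | _, 0 => by simp [qBinom_zero_right]
  | 0, _ + 1 => by simp [qBinom]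
  | n + 1, k + 1 => by
    simp [qBinom_succ_succ, map_qBinom φ q n k, map_qBinom φ q n (k + 1)]

end QBinomial

theorem two_mul_choose_two (k : ℕ) : 2 * (k.choose 2 : ℤ) = k * (k - 1) := by
  induction k with
  | zero => simp
  | succ k ih =>
    rw [Nat.choose_succ_succ' k 1, Nat.choose_one_right]
    push_cast
    linarith

/-- A finite form of the Gauss square identity. -/
theorem sq_prod_one_sub_odd_pow (N : ℕ) :
    (∏ i ∈ range N, (1 - (X : ℤ⟦X⟧) ^ (2 * i + 1))) ^ 2 =
      ∑ k ∈ range (2 * N + 1),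
        (-1) ^ (N + k) * X ^ (((k : ℤ) - N).natAbs ^ 2) * qBinom (X ^ 2) (2 * N) k := by
  rcases N with _ | N
  · simp [qBinom_zero_right]
  have hX : (X : ℤ⟦X⟧) ^ ((N + 1) * N + (N + 1) * (2 * N + 1)) * (-1) ^ (N + 1) ≠ 0 :=
    mul_ne_zero (pow_ne_zero _ X_ne_zero) (pow_ne_zero _ (by simp))
  apply mul_left_cancel₀ hX
  have h := prod_add_mul_pow_eq_sum_qBinom (X ^ 2 : ℤ⟦X⟧) (X ^ (2 * N + 1)) (-1) (2 * (N + 1))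
  rw [two_mul (N + 1), prod_range_add] at h
  have hlow : ∏ i ∈ range (N + 1), ((X : ℤ⟦X⟧) ^ (2 * N + 1) + -1 * (X ^ 2) ^ i) =
      X ^ ((N + 1) * N) * (-1) ^ (N + 1) * ∏ i ∈ range (N + 1), (1 - X ^ (2 * i + 1)) := by
    rw [← prod_range_reflect (fun i => 1 - (X : ℤ⟦X⟧) ^ (2 * i + 1))]
    have hsum : (X : ℤ⟦X⟧) ^ ((N + 1) * N) = ∏ i ∈ range (N + 1), X ^ (2 * i) := by
      rw [prod_pow_eq_pow_sum, ← mul_sum, mul_comm 2, sum_range_id_mul_two, Nat.add_sub_cancel]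
    have hneg : (-1 : ℤ⟦X⟧) ^ (N + 1) = ∏ i ∈ range (N + 1), (-1) := by simp
    rw [hsum, hneg, ← prod_mul_distrib, ← prod_mul_distrib]
    refine prod_congr rfl fun i hi => ?_
    have hi := mem_range.1 hi
    have : (X : ℤ⟦X⟧) ^ (2 * N + 1) = X ^ (2 * i) * X ^ (2 * (N + 1 - 1 - i) + 1) := by
      rw [← pow_add]; congr 1; omega
    rw [this]
    ring
  have hhigh : ∏ i ∈ range (N + 1), ((X : ℤ⟦X⟧) ^ (2 * N + 1) + -1 * (X ^ 2) ^ (N + 1 + i)) =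
      X ^ ((N + 1) * (2 * N + 1)) * ∏ i ∈ range (N + 1), (1 - X ^ (2 * i + 1)) := by
    have hpow : (X : ℤ⟦X⟧) ^ ((N + 1) * (2 * N + 1)) = ∏ i ∈ range (N + 1), X ^ (2 * N + 1) := by
      simp [← pow_mul, mul_comm]
    rw [hpow, ← prod_mul_distrib]
    exact prod_congr rfl fun i _ => by ring
  rw [hlow, hhigh] at h
  rw [pow_add X]
  refine Eq.trans (by ring) (h.trans ?_)
  rw [← pow_add X, mul_sum, ← two_mul]
  refine sum_congr rfl fun k hk => ?_
  have hk := mem_range.1 hk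
  rw [← pow_mul, ← pow_mul]
  have hexp : 2 * k.choose 2 + (2 * N + 1) * (2 * (N + 1) - k) =
      (N + 1) * N + (N + 1) * (2 * N + 1) + ((k : ℤ) - (N + 1 : ℕ)).natAbs ^ 2 := by
    zify
    rw [Nat.cast_sub (by omega), sq_abs, two_mul_choose_two]
    push_cast
    ring
  have hsign : (-1 : ℤ⟦X⟧) ^ k = (-1) ^ (N + 1) * (-1) ^ (N + 1 + k) := by
    rw [← pow_add, show N + 1 + (N + 1 + k) = 2 * (N + 1) + k by ring, pow_add, pow_mul]
    simp
  calc _ = X ^ (2 * k.choose 2 + (2 * N + 1) * (2 * (N + 1) - k)) *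
        qBinom (X ^ 2) (2 * (N + 1)) k * (-1 : ℤ⟦X⟧) ^ k := by ring
    _ = _ := by rw [hexp, hsign]; ring

theorem mk_span_singleton_pow_self {R : Type*} [CommRing R] (x : R) (n : ℕ) :
    Ideal.Quotient.mk (Ideal.span {x ^ n}) x ^ n = 0 := by
  rw [← map_pow]
  exact Ideal.Quotient.eq_zero_iff_mem.2 (Ideal.mem_span_singleton_self _)

theorem X_pow_dvd_qBinom_mul_qPoch_sub_one {m k l : ℕ} (hk : m ≤ k) (hl : m ≤ l) :
    (X : ℤ⟦X⟧) ^ (2 * (m + 1)) ∣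
      qBinom (X ^ 2) (k + l) k * qPoch (X ^ 2) (k + l) - 1 := by
  rw [← Ideal.mem_span_singleton, ← Ideal.Quotient.eq_zero_iff_mem, map_sub, map_mul, map_qBinom,
    map_qPoch, map_one, sub_eq_zero]
  refine qBinom_mul_qPoch_eq_one ?_ hk hl
  rw [map_pow, ← pow_mul, mk_span_singleton_pow_self]

/-- The partial sum of the theta series `∑ (-1)ⁿ q^(n²)` over `-N ≤ n ≤ N`. -/
noncomputable def thetaPartial (N : ℕ) : ℤ⟦X⟧ :=
  ∑ k ∈ range (2 * N + 1), (-1) ^ (N + k) * X ^ (((k : ℤ) - N).natAbs ^ 2)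

theorem X_pow_dvd_gauss (N : ℕ) :
    (X : ℤ⟦X⟧) ^ (2 * N + 1) ∣
      (∏ i ∈ range N, (1 - X ^ (2 * i + 1))) ^ 2 * qPoch (X ^ 2) (2 * N) - thetaPartial N := by
  rw [sq_prod_one_sub_odd_pow, thetaPartial, sum_mul, ← sum_sub_distrib]
  refine dvd_sum fun k hk => ?_
  have hk := mem_range.1 hk
  set d := ((k : ℤ) - N).natAbs with hd
  obtain ⟨c, hc⟩ := X_pow_dvd_qBinom_mul_qPoch_sub_one (m := N - d) (k := k) (l := 2 * N - k)
    (by omega) (by omega)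
  rw [Nat.add_sub_of_le (by omega)] at hc
  have hle : 2 * N + 1 ≤ d ^ 2 + 2 * (N - d + 1) := by
    have : d ≤ N := by omega
    zify [this]
    nlinarith [sq_nonneg ((d : ℤ) - 1)]
  refine (pow_dvd_pow X hle).trans ⟨(-1) ^ (N + k) * c, ?_⟩
  rw [pow_add]
  linear_combination ((-1) ^ (N + k) * X ^ d ^ 2) * hc

theorem X_pow_dvd_sumGenFun_mul_thetaPartial (N : ℕ) :
    (X : ℤ⟦X⟧) ^ (2 * N + 1) ∣
      sumGenFun (boundedIs01 (2 * N) (2 * N)) * thetaPartial N - 1 := by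
  have hgen := sumGenFun_boundedIs01_mul_prod (2 * N)
  have hgauss := X_pow_dvd_gauss N
  rw [← Ideal.mem_span_singleton, ← Ideal.Quotient.eq_zero_iff_mem] at hgauss ⊢
  set φ := Ideal.Quotient.mk (Ideal.span {(X : ℤ⟦X⟧) ^ (2 * N + 1)})
  have hX : φ X ^ (2 * N + 1) = 0 := mk_span_singleton_pow_self _ _
  have hodd : φ (∏ i ∈ range (2 * N), (1 - X ^ (2 * i + 1))) =
      φ (∏ i ∈ range N, (1 - X ^ (2 * i + 1))) := by
    have htail (i : ℕ) : φ (1 - X ^ (2 * (N + i) + 1)) = 1 := by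
      rw [map_sub, map_pow, pow_eq_zero_of_le (by omega) hX, map_one, sub_zero]
    rw [show range (2 * N) = range (N + N) by rw [two_mul], prod_range_add, map_mul,
      map_prod φ (fun i => 1 - (X : ℤ⟦X⟧) ^ (2 * (N + i) + 1)), prod_congr rfl fun i _ => htail i,
      prod_const_one, mul_one]
  have heven : φ (qPoch (X ^ 2) (2 * N)) = φ (qPoch (X ^ 2) N) := by
    rw [map_qPoch, map_qPoch]
    refine qPoch_eq_of_pow_eq_zero ?_ (by omega)
    rw [map_pow, ← pow_mul]
    exact pow_eq_zero_of_le (by omega) hX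
  have hgen' := congrArg φ hgen
  change φ (_ * (qPoch X (2 * N) * _)) = _ at hgen'
  rw [qPoch_two_mul] at hgen'
  simp only [map_mul, hodd, map_one] at hgen'
  simp only [map_sub, map_mul, map_pow φ (∏ i ∈ range N, _), map_one, heven] at hgauss ⊢
  linear_combination hgen' - φ (sumGenFun (boundedIs01 (2 * N) (2 * N))) * hgauss

theorem thetaPartial_eq (N : ℕ) :
    thetaPartial N = 1 + 2 * ∑ j ∈ range N, (-1) ^ (j + 1) * X ^ ((j + 1) ^ 2) := by
  rw [thetaPartial, two_mul N, add_assoc, sum_range_add, sum_range_succ', two_mul,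
    ← sum_range_reflect]
  have h1 : ∑ j ∈ range N, (-1 : ℤ⟦X⟧) ^ (N + (N - 1 - j)) *
      X ^ ((((N - 1 - j : ℕ) : ℤ) - N).natAbs ^ 2) =
        ∑ j ∈ range N, (-1) ^ (j + 1) * X ^ ((j + 1) ^ 2) := by
    refine sum_congr rfl fun j hj => ?_
    have hj := mem_range.1 hj
    congr 1
    · rw [neg_one_pow_congr]
      simp only [Nat.even_iff]
      omega
    · congr 2
      omega
  have h2 : ∑ j ∈ range N, (-1 : ℤ⟦X⟧) ^ (N + (N + (j + 1))) *
      X ^ ((((N + (j + 1) : ℕ) : ℤ) - N).natAbs ^ 2) =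
        ∑ j ∈ range N, (-1) ^ (j + 1) * X ^ ((j + 1) ^ 2) := by
    refine sum_congr rfl fun j _ => ?_
    congr 1
    · rw [neg_one_pow_congr]
      simp only [Nat.even_iff]
      omega
    · congr 2
      omega
  rw [h1, h2]
  simp [← two_mul, pow_mul]
  ring

section Residue

/-- The power series supported on exponents congruent to `r` modulo `m`. -/
def residueSubgroup (m : ℕ) (r : ZMod m) : AddSubgroup ℤ⟦X⟧ where
  carrier := {f | ∀ n : ℕ, (n : ZMod m) ≠ r → coeff n f = 0}
  zero_mem' := by simp
  add_mem' hf hg n hn := by simp [hf n hn, hg n hn]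
  neg_mem' hf n hn := by simp [hf n hn]

variable {m : ℕ} {r s : ZMod m} {f g : ℤ⟦X⟧}

theorem mul_mem_residueSubgroup (hf : f ∈ residueSubgroup m r) (hg : g ∈ residueSubgroup m s) :
    f * g ∈ residueSubgroup m (r + s) := by
  intro n hn
  rw [coeff_mul]
  refine sum_eq_zero fun p hp => ?_
  by_cases h1 : (p.1 : ZMod m) = r
  · have h2 : (p.2 : ZMod m) ≠ s := by
      rintro rfl
      exact hn (by rw [← h1, ← Nat.cast_add, mem_antidiagonal.1 hp])
    rw [hg _ h2, mul_zero]
  · rw [hf _ h1, zero_mul]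

theorem pow_mem_residueSubgroup (hf : f ∈ residueSubgroup m r) (k : ℕ) :
    f ^ k ∈ residueSubgroup m (k * r) := by
  induction k with
  | zero =>
    intro n hn
    rw [pow_zero, coeff_one, if_neg]
    rintro rfl
    simp at hn
  | succ k ih =>
    rw [pow_succ, Nat.cast_succ, add_one_mul]
    exact mul_mem_residueSubgroup ih hf

theorem neg_one_pow_mul_X_pow_mem_residueSubgroup (j n : ℕ) (h : (n : ZMod m) = r) :
    (-1 : ℤ⟦X⟧) ^ j * X ^ n ∈ residueSubgroup m r := by
  intro k hk
  have hX : coeff k (X ^ n : ℤ⟦X⟧) = 0 := by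
    rw [coeff_X_pow, if_neg]
    rintro rfl
    exact hk h
  rcases neg_one_pow_eq_or ℤ⟦X⟧ j with h' | h' <;> simp [h', hX]

end Residue

theorem dvd_coeff_add_pow {A E : ℤ⟦X⟧} (hA : A ∈ residueSubgroup 8 1)
    (hA' : A ∈ residueSubgroup 4 1) (hE : E ∈ residueSubgroup 4 0) (n : ℕ) :
    (64 : ℤ) ∣ coeff (8 * n + 7) (1 - 2 * (A + E) + 4 * (A + E) ^ 2 - 8 * (A + E) ^ 3 +
      16 * (A + E) ^ 4 - 32 * (A + E) ^ 5) := by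
  have hmod : ((8 * n + 7 : ℕ) : ZMod 4) = 3 := by
    rw [show 8 * n + 7 = 4 * (2 * n + 1) + 3 by ring, Nat.cast_add, Nat.cast_mul]
    simp [show (4 : ZMod 4) = 0 from rfl]
  have hzero (i j : ℕ) (hi : (i : ZMod 4) ≠ 3) : coeff (8 * n + 7) (A ^ i * E ^ j) = 0 := by
    refine mul_mem_residueSubgroup (pow_mem_residueSubgroup hA' i) (pow_mem_residueSubgroup hE j)
      _ ?_
    rw [hmod]
    simpa using hi.symm
  have hcube : coeff (8 * n + 7) (A ^ 3) = 0 := by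
    refine pow_mem_residueSubgroup hA 3 _ ?_
    rw [Nat.cast_add, Nat.cast_mul, show ((8 : ℕ) : ZMod 8) = 0 from rfl, zero_mul]
    decide
  have hexpand : 1 - 2 * (A + E) + 4 * (A + E) ^ 2 - 8 * (A + E) ^ 3 + 16 * (A + E) ^ 4 -
      32 * (A + E) ^ 5 =
      (A ^ 0 * E ^ 0 - (2 : ℤ) • (A ^ 0 * E ^ 1) + (4 : ℤ) • (A ^ 0 * E ^ 2)
        - (8 : ℤ) • (A ^ 0 * E ^ 3) + (16 : ℤ) • (A ^ 0 * E ^ 4) - (32 : ℤ) • (A ^ 0 * E ^ 5)) +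
      (-(2 : ℤ) • (A ^ 1 * E ^ 0) + (8 : ℤ) • (A ^ 1 * E ^ 1) - (24 : ℤ) • (A ^ 1 * E ^ 2)
        + (64 : ℤ) • (A ^ 1 * E ^ 3) - (160 : ℤ) • (A ^ 1 * E ^ 4)) +
      ((4 : ℤ) • (A ^ 2 * E ^ 0) - (24 : ℤ) • (A ^ 2 * E ^ 1) + (96 : ℤ) • (A ^ 2 * E ^ 2)
        - (320 : ℤ) • (A ^ 2 * E ^ 3)) +
      ((16 : ℤ) • (A ^ 4 * E ^ 0) - (160 : ℤ) • (A ^ 4 * E ^ 1) - (32 : ℤ) • (A ^ 5 * E ^ 0)) -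
      (8 : ℤ) • A ^ 3 + (64 : ℤ) • (A ^ 3 * E - (5 : ℤ) • (A ^ 3 * E ^ 2)) := by
    simp only [zsmul_eq_mul]
    push_cast
    ring
  refine ⟨coeff (8 * n + 7) (A ^ 3 * E - (5 : ℤ) • (A ^ 3 * E ^ 2)), ?_⟩
  rw [hexpand]
  simp only [map_add, map_sub, map_zsmul, hcube, hzero 0 _ (by decide), hzero 1 _ (by decide),
    hzero 2 _ (by decide), hzero 4 _ (by decide), hzero 5 _ (by decide), smul_eq_mul]
  ring

theorem theta_split (N : ℕ) : ∃ A E : ℤ⟦X⟧,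
    A ∈ residueSubgroup 8 1 ∧ A ∈ residueSubgroup 4 1 ∧ E ∈ residueSubgroup 4 0 ∧
      thetaPartial N = 1 + 2 * (A + E) := by
  have hodd (j : ℕ) (hj : Even j) : (j + 1) ^ 2 % 8 = 1 := by
    rw [Nat.pow_mod]
    have := Nat.even_iff.1 hj
    have : (j + 1) % 8 = 1 ∨ (j + 1) % 8 = 3 ∨ (j + 1) % 8 = 5 ∨ (j + 1) % 8 = 7 := by omega
    rcases this with h | h | h | h <;> rw [h]
  refine ⟨_, _, sum_mem fun j hj => ?_, sum_mem fun j hj => ?_, sum_mem fun j hj => ?_,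
    (thetaPartial_eq N).trans (by rw [sum_filter_add_sum_filter_not (range N) Even])⟩
  · refine neg_one_pow_mul_X_pow_mem_residueSubgroup _ _ ?_
    have := hodd j (mem_filter.1 hj).2
    exact_mod_cast (ZMod.natCast_eq_natCast_iff' _ 1 8).2 this
  · refine neg_one_pow_mul_X_pow_mem_residueSubgroup _ _ ?_
    have := hodd j (mem_filter.1 hj).2
    exact_mod_cast (ZMod.natCast_eq_natCast_iff' _ 1 4).2 (by omega)
  · refine neg_one_pow_mul_X_pow_mem_residueSubgroup _ _ ?_
    obtain ⟨i, hi⟩ := (Nat.not_even_iff_odd.1 (mem_filter.1 hj).2).add_one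
    rw [ZMod.natCast_eq_zero_iff]
    exact ⟨i ^ 2, by rw [hi]; ring⟩

/-- `j(8n+7) ≡ 0 (mod 64)`. -/
theorem jagged_cong_64 (n : ℕ) : 64 ∣ j01 (8 * n + 7) := by
  set N := 8 * n + 7
  obtain ⟨A, E, hA, hA', hE, hθ⟩ := theta_split N
  obtain ⟨c, hc⟩ := X_pow_dvd_sumGenFun_mul_thetaPartial N
  rw [← Int.natCast_dvd_natCast, ← coeff_sumGenFun_boundedIs01 (show N ≤ 2 * N by omega)]
  set S := sumGenFun (boundedIs01 (2 * N) (2 * N))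
  set W := 1 - 2 * (A + E) + 4 * (A + E) ^ 2 - 8 * (A + E) ^ 3 + 16 * (A + E) ^ 4 -
    32 * (A + E) ^ 5 with hW
  have hS : S = W + (64 : ℤ) • ((A + E) ^ 6 * S) + X ^ (2 * N + 1) * (c * W) := by
    rw [hθ] at hc
    rw [zsmul_eq_mul, hW]
    push_cast
    linear_combination W * hc
  rw [hS, map_add, map_add, map_zsmul, smul_eq_mul, coeff_X_pow_mul', if_neg (by omega), add_zero]
  exact dvd_add (dvd_coeff_add_pow hA hA' hE n) (dvd_mul_right _ _)
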